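/- The subgroup of GL(4,k) generated by ι(GL(2,k)) ∪ κ ι(GL(2,k)) κ⁻¹ equals the set H = {Ψ(g₁,g₂) : g₁, g₂ ∈ GL(2,k), det g₁ = det g₂}. -/

import Mathlib

open Matrix

/-- The embedding `ι : GL(2,k) → GL(4,k)` on the level of matrices. -/
def iotaMat {k : Type*} [Field k] (g : Matrix (Fin 2) (Fin 2) k) :
    Matrix (Fin 4) (Fin 4) k :=
  !![g.det, 0, 0, 0;
     0, g 0 0, 0, g 0 1;
     0, 0, 1, 0;
     0, g 1 0, 0, g 1 1]

/-- The involution `κ`, a 4×4 permutation matrix. -/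
def kappaMat (k : Type*) [Field k] : Matrix (Fin 4) (Fin 4) k :=
  !![0, 1, 0, 0;
     1, 0, 0, 0;
     0, 0, 0, 1;
     0, 0, 1, 0]

/-- The map `Ψ` interleaving a pair of 2×2 matrices into a 4×4 matrix. -/
def PsiMat {k : Type*} [Field k] (g₁ g₂ : Matrix (Fin 2) (Fin 2) k) :
    Matrix (Fin 4) (Fin 4) k :=
  !![g₁ 0 0, 0, g₁ 0 1, 0;
     0, g₂ 0 0, 0, g₂ 0 1;
     g₁ 1 0, 0, g₁ 1 1, 0;
     0, g₂ 1 0, 0, g₂ 1 1]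

theorem PsiMat_mul {k : Type*} [Field k] (a b c d : Matrix (Fin 2) (Fin 2) k) :
    PsiMat a b * PsiMat c d = PsiMat (a * c) (b * d) := by
  ext i j
  fin_cases i <;> fin_cases j <;>
    simp [PsiMat, Matrix.mul_apply, Fin.sum_univ_succ]

theorem PsiMat_one {k : Type*} [Field k] :
    PsiMat (1 : Matrix (Fin 2) (Fin 2) k) 1 = 1 := by
  ext i j
  fin_cases i <;> fin_cases j <;> simp [PsiMat]

/-- `Ψ` as a map into `GL(4,k)`. -/
def PsiU {k : Type*} [Field k] (g h : GL (Fin 2) k) : GL (Fin 4) k where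
  val := PsiMat g.val h.val
  inv := PsiMat (g⁻¹).val (h⁻¹).val
  val_inv := by
    rw [PsiMat_mul, ← Units.val_mul, ← Units.val_mul, mul_inv_cancel, mul_inv_cancel]
    exact PsiMat_one
  inv_val := by
    rw [PsiMat_mul, ← Units.val_mul, ← Units.val_mul, inv_mul_cancel, inv_mul_cancel]
    exact PsiMat_one

theorem PsiU_val {k : Type*} [Field k] (g h : GL (Fin 2) k) :
    (PsiU g h).val = PsiMat g.val h.val := rfl

theorem PsiU_inv {k : Type*} [Field k] (g h : GL (Fin 2) k) :
    (PsiU g h)⁻¹ = PsiU g⁻¹ h⁻¹ := Units.ext rfl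

theorem PsiU_mul {k : Type*} [Field k] (a b c d : GL (Fin 2) k) :
    PsiU a b * PsiU c d = PsiU (a * c) (b * d) := Units.ext (PsiMat_mul _ _ _ _)

theorem GL2_det_ne {k : Type*} [Field k] (g : GL (Fin 2) k) : g.val.det ≠ 0 :=
  ((Matrix.isUnit_iff_isUnit_det _).1 g.isUnit).ne_zero

/-- The matrix `diag(det g, 1)`. -/
noncomputable def dg {k : Type*} [Field k] (g : GL (Fin 2) k) : GL (Fin 2) k :=
  Matrix.GeneralLinearGroup.mkOfDetNeZero !![g.val.det, 0; 0, 1]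
    (by rw [Matrix.det_fin_two_of]; simpa using GL2_det_ne g)

theorem dg_val {k : Type*} [Field k] (g : GL (Fin 2) k) :
    (dg g).val = !![g.val.det, 0; 0, 1] := rfl

theorem dg_det {k : Type*} [Field k] (g : GL (Fin 2) k) : (dg g).val.det = g.val.det := by
  rw [dg_val, Matrix.det_fin_two_of]; simp

theorem iota_eq {k : Type*} [Field k] (g : GL (Fin 2) k) :
    iotaMat g.val = PsiMat (dg g).val g.val := by
  rw [dg_val]
  ext i j
  fin_cases i <;> fin_cases j <;> simp [PsiMat, iotaMat]

theorem kappa_sq (k : Type*) [Field k] : kappaMat k * kappaMat k = 1 := by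
  ext i j
  fin_cases i <;> fin_cases j <;>
    simp [kappaMat, Matrix.mul_apply, Fin.sum_univ_succ]

theorem kappa_conj {k : Type*} [Field k] (a b : Matrix (Fin 2) (Fin 2) k) :
    kappaMat k * PsiMat a b * (kappaMat k)⁻¹ = PsiMat b a := by
  rw [Matrix.inv_eq_right_inv (kappa_sq k)]
  ext i j
  fin_cases i <;> fin_cases j <;>
    simp [kappaMat, PsiMat, Matrix.mul_apply, Fin.sum_univ_succ]

/-- The subgroup of GL(4,k) generated by `ι(GL(2,k)) ∪ κ ι(GL(2,k)) κ⁻¹` is exactly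
`H = {Ψ(g₁,g₂) : det g₁ = det g₂}`. -/
theorem stmt4 (k : Type*) [Field k] :
    ((Subgroup.closure
        ({u : GL (Fin 4) k | ∃ g : GL (Fin 2) k,
            (u : Matrix (Fin 4) (Fin 4) k) = iotaMat (g : Matrix (Fin 2) (Fin 2) k)} ∪
         {u : GL (Fin 4) k | ∃ g : GL (Fin 2) k,
            (u : Matrix (Fin 4) (Fin 4) k) =
              kappaMat k * iotaMat (g : Matrix (Fin 2) (Fin 2) k) * (kappaMat k)⁻¹})) :
      Set (GL (Fin 4) k)) =
    {u : GL (Fin 4) k | ∃ g₁ g₂ : GL (Fin 2) k,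
      (g₁ : Matrix (Fin 2) (Fin 2) k).det = (g₂ : Matrix (Fin 2) (Fin 2) k).det ∧
      (u : Matrix (Fin 4) (Fin 4) k) =
        PsiMat (g₁ : Matrix (Fin 2) (Fin 2) k) (g₂ : Matrix (Fin 2) (Fin 2) k)} := by
  apply Set.Subset.antisymm
  · intro u hu
    have hu' : u ∈ Subgroup.closure _ := hu
    clear hu
    suffices h : ∃ g₁ g₂ : GL (Fin 2) k, g₁.val.det = g₂.val.det ∧ u = PsiU g₁ g₂ by
      obtain ⟨g₁, g₂, h1, rfl⟩ := h
      exact ⟨g₁, g₂, h1, rfl⟩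
    induction hu' using Subgroup.closure_induction with
    | mem x hx =>
      rcases hx with ⟨g, hg⟩ | ⟨g, hg⟩
      · exact ⟨dg g, g, dg_det g, Units.ext (hg.trans (iota_eq g))⟩
      · refine ⟨g, dg g, (dg_det g).symm, Units.ext (hg.trans ?_)⟩
        rw [iota_eq, kappa_conj]; rfl
    | one => exact ⟨1, 1, rfl, Units.ext PsiMat_one.symm⟩
    | mul x y _ _ hx hy =>
      obtain ⟨a, b, h1, rfl⟩ := hx
      obtain ⟨c, d, h2, rfl⟩ := hy
      refine ⟨a * c, b * d, ?_, PsiU_mul _ _ _ _⟩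
      rw [Units.val_mul, Units.val_mul, Matrix.det_mul, Matrix.det_mul, h1, h2]
    | inv x _ hx =>
      obtain ⟨a, b, h1, rfl⟩ := hx
      refine ⟨a⁻¹, b⁻¹, ?_, PsiU_inv _ _⟩
      rw [Matrix.coe_units_inv, Matrix.coe_units_inv, Matrix.det_nonsing_inv,
        Matrix.det_nonsing_inv, h1]
  · rintro u ⟨g₁, g₂, h, hu⟩
    have hu2 : u = PsiU g₁ (dg g₁) * PsiU 1 ((dg g₁)⁻¹ * g₂) := by
      rw [PsiU_mul, mul_one, mul_inv_cancel_left]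
      exact Units.ext hu
    rw [hu2]
    refine Subgroup.mul_mem _ (Subgroup.subset_closure (Or.inr ⟨g₁, ?_⟩))
      (Subgroup.subset_closure (Or.inl ⟨(dg g₁)⁻¹ * g₂, ?_⟩))
    · rw [iota_eq, kappa_conj]; rfl
    · have hd : ((dg g₁)⁻¹ * g₂).val.det = 1 := by
        rw [Units.val_mul, Matrix.det_mul, Matrix.coe_units_inv, Matrix.det_nonsing_inv,
          dg_det, h, Ring.inverse_eq_inv']
        exact inv_mul_cancel₀ (GL2_det_ne g₂)
      have h1 : dg ((dg g₁)⁻¹ * g₂) = 1 := by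
        apply Units.ext
        rw [dg_val, hd, Units.val_one, Matrix.one_fin_two]
      rw [iota_eq, h1]; rfl
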